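/- The set of binary quadratic forms f(x,y) ∈ O_{K,S}[x,y] with discriminant Δ(f) = 1 decomposes into finitely many orbits under the linear-substitution action of SL₂(O_{K,S}). -/

import Mathlib

open IsDedekindDomain NumberField

set_option synthInstance.maxHeartbeats 1000000
set_option maxHeartbeats 1000000

/-- The discriminant `b² - 4ac` of a binary quadratic form
`f = a·x² + b·xy + c·y²` over a commutative ring. -/
noncomputable def disc2 {R : Type*} [CommRing R] (f : MvPolynomial (Fin 2) R) : R :=
  f.coeff (Finsupp.single 0 1 + Finsupp.single 1 1) ^ 2 -
    4 * f.coeff (Finsupp.single 0 2) * f.coeff (Finsupp.single 1 2)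

/-- The linear-substitution action of a matrix on binary forms:
`(γ·f)(x,y) = f((x,y)γ)`. -/
noncomputable def substForm {R : Type*} [CommRing R] (γ : Matrix (Fin 2) (Fin 2) R)
    (f : MvPolynomial (Fin 2) R) : MvPolynomial (Fin 2) R :=
  MvPolynomial.bind₁ (fun i => ∑ j, MvPolynomial.C (γ j i) * MvPolynomial.X j) f

open MvPolynomial in
/-- The binary quadratic form `a·x² + b·xy + c·y²`. -/
noncomputable def quadForm {R : Type*} [CommRing R] (a b c : R) : MvPolynomial (Fin 2) R :=
  C a * X 0 ^ 2 + C b * (X 0 * X 1) + C c * X 1 ^ 2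

section CommRing

variable {R : Type*} [CommRing R]

open MvPolynomial in
theorem quadForm_isHomogeneous (a b c : R) : (quadForm a b c).IsHomogeneous 2 := by
  have h0 := isHomogeneous_X R (0 : Fin 2)
  have h1 := isHomogeneous_X R (1 : Fin 2)
  have hC (r : R) := isHomogeneous_C (Fin 2) r
  exact (((hC a).mul (h0.pow 2)).add ((hC b).mul (h0.mul h1))).add ((hC c).mul (h1.pow 2))

open MvPolynomial in
theorem quadForm_eq_monomials (a b c : R) :
    quadForm a b c = monomial (Finsupp.single 0 2) a +
      monomial (Finsupp.single 0 1 + Finsupp.single 1 1) b + monomial (Finsupp.single 1 2) c := by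
  simp only [quadForm, X_pow_eq_monomial]
  simp only [X, monomial_mul, C_mul_monomial, mul_one]

theorem finsupp_fin_two_of_degree_eq_two {d : Fin 2 →₀ ℕ} (hd : d.degree = 2) :
    d = Finsupp.single 0 2 ∨ d = Finsupp.single 0 1 + Finsupp.single 1 1 ∨
      d = Finsupp.single 1 2 := by
  have h : d 0 + d 1 = 2 := by
    rwa [Finsupp.degree_eq_sum, Fin.sum_univ_two] at hd
  simp only [Finsupp.ext_iff, Fin.forall_fin_two, Finsupp.add_apply, Finsupp.single_apply]
  simp
  omega

theorem single_ne_single_fin_two :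
    (Finsupp.single 0 2 : Fin 2 →₀ ℕ) ≠ Finsupp.single 0 1 + Finsupp.single 1 1 ∧
    (Finsupp.single 0 2 : Fin 2 →₀ ℕ) ≠ Finsupp.single 1 2 ∧
    (Finsupp.single 1 2 : Fin 2 →₀ ℕ) ≠ Finsupp.single 0 1 + Finsupp.single 1 1 := by
  simp [Finsupp.ext_iff, Fin.forall_fin_two, Finsupp.single_apply]

open MvPolynomial in
theorem coeff_quadForm (a b c : R) :
    (quadForm a b c).coeff (Finsupp.single 0 2) = a ∧
    (quadForm a b c).coeff (Finsupp.single 0 1 + Finsupp.single 1 1) = b ∧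
    (quadForm a b c).coeff (Finsupp.single 1 2) = c := by
  obtain ⟨h1, h2, h3⟩ := single_ne_single_fin_two
  simp only [quadForm_eq_monomials, coeff_add, coeff_monomial]
  simp [h1, h2, h3, h1.symm, h2.symm, h3.symm]

theorem disc2_quadForm (a b c : R) : disc2 (quadForm a b c) = b ^ 2 - 4 * a * c := by
  obtain ⟨ha, hb, hc⟩ := coeff_quadForm a b c
  rw [disc2, ha, hb, hc]

theorem MvPolynomial.IsHomogeneous.exists_eq_quadForm {f : MvPolynomial (Fin 2) R}
    (hf : f.IsHomogeneous 2) : ∃ a b c, f = quadForm a b c := by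
  refine ⟨f.coeff (Finsupp.single 0 2), f.coeff (Finsupp.single 0 1 + Finsupp.single 1 1),
    f.coeff (Finsupp.single 1 2), ?_⟩
  obtain ⟨ha, hb, hc⟩ := coeff_quadForm (f.coeff (Finsupp.single 0 2))
    (f.coeff (Finsupp.single 0 1 + Finsupp.single 1 1)) (f.coeff (Finsupp.single 1 2))
  ext d
  by_cases hd : d.degree = 2
  · rcases finsupp_fin_two_of_degree_eq_two hd with rfl | rfl | rfl
    · exact ha.symm
    · exact hb.symm
    · exact hc.symm
  · rw [hf.coeff_eq_zero hd, (quadForm_isHomogeneous _ _ _).coeff_eq_zero hd]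

open MvPolynomial in
theorem substForm_quadForm (p q r s a b c : R) :
    substForm !![p, q; r, s] (quadForm a b c) =
      quadForm (a * p ^ 2 + b * (p * q) + c * q ^ 2)
        (2 * a * p * r + b * (p * s + q * r) + 2 * c * q * s)
        (a * r ^ 2 + b * (r * s) + c * s ^ 2) := by
  have h2 : (C 2 : MvPolynomial (Fin 2) R) = 2 := map_ofNat C 2
  simp only [substForm, quadForm, map_add, map_mul, map_pow, bind₁_X_right, bind₁_C_right,
    Fin.sum_univ_two, Matrix.of_apply, Matrix.cons_val', Matrix.cons_val_zero,
    Matrix.cons_val_one, Matrix.cons_val_fin_one, h2]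
  ring

/-- A form of discriminant one with vanishing `x²`-coefficient is in the orbit of `xy`. -/
theorem exists_substForm_xy [IsDomain R] {b : R} (c : R) (hb : b ^ 2 = 1) :
    ∃ γ : Matrix.SpecialLinearGroup (Fin 2) R,
      quadForm 0 b c = substForm (γ : Matrix (Fin 2) (Fin 2) R) (quadForm 0 1 0) := by
  rcases (sq_eq_sq_iff_eq_or_eq_neg.1 (hb.trans (one_pow 2).symm)) with rfl | rfl
  · refine ⟨⟨!![1, 0; c, 1], by simp [Matrix.det_fin_two]⟩, ?_⟩
    rw [substForm_quadForm]
    congr 1 <;> ring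
  · refine ⟨⟨!![0, -1; 1, c], by simp [Matrix.det_fin_two]⟩, ?_⟩
    rw [substForm_quadForm]
    congr 1 <;> ring

theorem span_pair_mul_span_pair_succ {a t c : R} (h : a * c = t * (t + 1)) :
    Ideal.span {a, t} * Ideal.span {a, t + 1} = Ideal.span {a} := by
  apply le_antisymm
  · rw [Ideal.span_pair_mul_span_pair, Ideal.span_le]
    rintro x (rfl | rfl | rfl | rfl) <;> rw [SetLike.mem_coe, Ideal.mem_span_singleton]
    · exact ⟨a, rfl⟩
    · exact ⟨t + 1, rfl⟩
    · exact ⟨t, mul_comm _ _⟩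
    · exact ⟨c, h.symm⟩
  · rw [Ideal.span_singleton_le_iff_mem]
    have h1 : a * (t + 1) ∈ Ideal.span {a, t} * Ideal.span {a, t + 1} :=
      Ideal.mul_mem_mul (Ideal.subset_span (by simp)) (Ideal.subset_span (by simp))
    have h2 : t * a ∈ Ideal.span {a, t} * Ideal.span {a, t + 1} :=
      Ideal.mul_mem_mul (Ideal.subset_span (by simp)) (Ideal.subset_span (by simp))
    convert sub_mem h1 h2 using 1
    ring

/-- Two forms `a·x² + (2t+1)·xy + c·y²` of discriminant one whose ideals `(a, t)` agree up to
principal factors are equivalent under `SL₂`. -/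
theorem exists_substForm_of_span_eq [IsDomain R] {a t c a' t' c' r r' : R}
    (ha : a ≠ 0) (ha' : a' ≠ 0) (hr : r ≠ 0) (hr' : r' ≠ 0)
    (h : a * c = t * (t + 1)) (h' : a' * c' = t' * (t' + 1))
    (hI : Ideal.span {r} * Ideal.span {a, t} = Ideal.span {r'} * Ideal.span {a', t'}) :
    ∃ γ : Matrix.SpecialLinearGroup (Fin 2) R,
      quadForm a (2 * t + 1) c =
        substForm (γ : Matrix (Fin 2) (Fin 2) R) (quadForm a' (2 * t' + 1) c') := by
  have hIJ := span_pair_mul_span_pair_succ h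
  have hIJ' := span_pair_mul_span_pair_succ h'
  have hJ : Ideal.span {r * a} * Ideal.span {a', t' + 1} =
      Ideal.span {r' * a'} * Ideal.span {a, t + 1} := by
    rw [← Ideal.span_singleton_mul_span_singleton, ← Ideal.span_singleton_mul_span_singleton,
      ← hIJ, ← hIJ', ← mul_assoc, hI]
    ring
  have memI (x) (hx : x ∈ Ideal.span {a, t}) :
      ∃ u ∈ Ideal.span {a', t'}, r' * u = r * x := by
    rw [← Ideal.mem_span_singleton_mul, ← hI]
    exact Ideal.mem_span_singleton_mul.2 ⟨x, hx, rfl⟩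
  have memJ (x) (hx : x ∈ Ideal.span {a, t + 1}) :
      ∃ v ∈ Ideal.span {a', t' + 1}, r * a * v = r' * a' * x := by
    rw [← Ideal.mem_span_singleton_mul, hJ]
    exact Ideal.mem_span_singleton_mul.2 ⟨x, hx, rfl⟩
  obtain ⟨u₁, hu₁, eu₁⟩ := memI a (Ideal.subset_span (by simp))
  obtain ⟨u₂, hu₂, eu₂⟩ := memI t (Ideal.subset_span (by simp))
  obtain ⟨v₁, hv₁, ev₁⟩ := memJ a (Ideal.subset_span (by simp))
  obtain ⟨v₂, hv₂, ev₂⟩ := memJ (t + 1) (Ideal.subset_span (by simp))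
  have dvd (u v) (hu : u ∈ Ideal.span {a', t'}) (hv : v ∈ Ideal.span {a', t' + 1}) :
      ∃ p, (t' + 1) * u - t' * v = a' * p := by
    have h1 := Ideal.mul_mem_mul hu (Ideal.subset_span (by simp) : t' + 1 ∈ Ideal.span {a', t' + 1})
    have h2 := Ideal.mul_mem_mul (Ideal.subset_span (by simp) : t' ∈ Ideal.span {a', t'}) hv
    rw [hIJ'] at h1 h2
    have h3 := Ideal.mem_span_singleton.1 (sub_mem h1 h2)
    rwa [mul_comm u] at h3
  obtain ⟨p, hp⟩ := dvd u₁ v₁ hu₁ hv₁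
  obtain ⟨q, hq⟩ := dvd u₂ v₂ hu₂ hv₂
  have hra : r * a * r' ≠ 0 := mul_ne_zero (mul_ne_zero hr ha) hr'
  have e₁₁ : u₁ * v₁ = a' * a := mul_left_cancel₀ hra <| by
    linear_combination (r * a * v₁) * eu₁ + r * a * ev₁
  have e₁₂ : u₁ * v₂ = a' * (t + 1) := mul_left_cancel₀ hra <| by
    linear_combination (r * a * v₂) * eu₁ + r * a * ev₂
  have e₂₁ : u₂ * v₁ = a' * t := mul_left_cancel₀ hra <| by
    linear_combination (r * a * v₁) * eu₂ + r * t * ev₁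
  have e₂₂ : u₂ * v₂ = a' * c := mul_left_cancel₀ hra <| by
    linear_combination (r * a * v₂) * eu₂ + r * t * ev₂ - r * r' * a' * h
  have l₁ : a' * p + t' * (v₁ - u₁) = u₁ := by linear_combination -hp
  have m₁ : a' * p + (t' + 1) * (v₁ - u₁) = v₁ := by linear_combination -hp
  have l₂ : a' * q + t' * (v₂ - u₂) = u₂ := by linear_combination -hq
  have m₂ : a' * q + (t' + 1) * (v₂ - u₂) = v₂ := by linear_combination -hq
  generalize v₁ - u₁ = w at *
  generalize v₂ - u₂ = z at *
  subst l₁ l₂ m₁ m₂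
  refine ⟨⟨!![p, w; q, z], ?_⟩, ?_⟩
  · rw [Matrix.det_fin_two_of]
    refine mul_left_cancel₀ ha' ?_
    linear_combination e₁₂ - e₂₁
  · rw [substForm_quadForm]
    congr 1 <;> refine mul_left_cancel₀ ha' ?_
    · linear_combination -e₁₁ - w ^ 2 * h'
    · linear_combination -e₁₂ - e₂₁ - 2 * w * z * h'
    · linear_combination -e₂₂ - z ^ 2 * h'

end CommRing

theorem Set.exists_finite_representatives {α β : Type*} [Finite β] (s : Set α) (c : α → β) :
    ∃ t ⊆ s, t.Finite ∧ ∀ x ∈ s, ∃ y ∈ t, c x = c y := by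
  obtain ⟨t, hts, ht⟩ := Set.exists_subset_bijOn s c
  refine ⟨t, hts, Set.Finite.of_finite_image (Set.toFinite _) ht.injOn, fun x hx ↦ ?_⟩
  obtain ⟨y, hy, hyx⟩ := ht.surjOn (Set.mem_image_of_mem c hx)
  exact ⟨y, hy, hyx.symm⟩

section SIntegers

variable {K : Type*} [Field K] [NumberField K] (S : Set (HeightOneSpectrum (𝓞 K)))

/-- The inclusion of the ring of integers into the ring of `S`-integers. -/
noncomputable def ringOfIntegersToInteger : 𝓞 K →+* S.integer K :=
  (algebraMap (𝓞 K) K).codRestrict (S.integer K) fun x v _ ↦ v.valuation_le_one x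

theorem ringOfIntegersToInteger_injective :
    Function.Injective (ringOfIntegersToInteger S) := fun _ _ h ↦
  FaithfulSMul.algebraMap_injective (𝓞 K) K (congrArg (S.integer K).subtype h)

/-- Elements of `K` satisfying `t² + t ∈ 𝒪_{K,S}` are `S`-integers. -/
theorem mem_integer_of_mul_succ_mem {t : K} (ht : t * (t + 1) ∈ S.integer K) :
    t ∈ S.integer K := by
  intro v hv
  have h := ht v hv
  by_contra! hlt
  rw [map_mul, Valuation.map_add_eq_of_lt_left _ (by rwa [map_one])] at h
  exact (h.trans_lt (one_lt_mul'' hlt hlt)).false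

theorem exists_eq_two_mul_add_one {a b c : S.integer K} (h : b ^ 2 - 4 * a * c = 1) :
    ∃ t, b = 2 * t + 1 ∧ a * c = t * (t + 1) := by
  have hK : (b : K) ^ 2 - 4 * a * c = 1 := by exact congrArg Subtype.val h
  have hac : ((b : K) - 1) / 2 * (((b : K) - 1) / 2 + 1) = (a * c : S.integer K) := by
    push_cast
    linear_combination hK / 4
  refine ⟨⟨((b : K) - 1) / 2, mem_integer_of_mul_succ_mem S (hac ▸ (a * c).2)⟩, ?_, ?_⟩
  · apply Subtype.ext
    change (b : K) = 2 * (((b : K) - 1) / 2) + 1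
    ring
  · exact Subtype.ext hac.symm

/-- Every nonzero ideal `(a, t)` of the `S`-integers is, up to a nonzero factor, extended from a
nonzero ideal of the ring of integers. -/
theorem exists_span_mul_span_pair_eq_map {a : S.integer K} (ha : a ≠ 0) (t : S.integer K) :
    ∃ d : S.integer K, d ≠ 0 ∧ ∃ I : nonZeroDivisors (Ideal (𝓞 K)),
      Ideal.span {d} * Ideal.span {a, t} = (I : Ideal (𝓞 K)).map (ringOfIntegersToInteger S) := by
  obtain ⟨x, m, hm, hx⟩ := IsFractionRing.div_surjective (A := 𝓞 K) (a : K)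
  obtain ⟨y, n, hn, hy⟩ := IsFractionRing.div_surjective (A := 𝓞 K) (t : K)
  have hm0 : algebraMap (𝓞 K) K m ≠ 0 := IsFractionRing.to_map_ne_zero_of_mem_nonZeroDivisors hm
  have hn0 : algebraMap (𝓞 K) K n ≠ 0 := IsFractionRing.to_map_ne_zero_of_mem_nonZeroDivisors hn
  set φ := ringOfIntegersToInteger S
  have hφa : φ (n * x) = φ (m * n) * a := by
    apply Subtype.ext
    change algebraMap (𝓞 K) K (n * x) = algebraMap (𝓞 K) K (m * n) * (a : K)
    rw [← hx, map_mul, map_mul]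
    field_simp
  have hφt : φ (m * y) = φ (m * n) * t := by
    apply Subtype.ext
    change algebraMap (𝓞 K) K (m * y) = algebraMap (𝓞 K) K (m * n) * (t : K)
    rw [← hy, map_mul, map_mul]
    field_simp
  have hmn : φ (m * n) ≠ 0 := by
    rw [map_ne_zero_iff _ (ringOfIntegersToInteger_injective S)]
    exact nonZeroDivisors.ne_zero (mul_mem hm hn)
  refine ⟨φ (m * n), hmn, ⟨Ideal.span {n * x, m * y}, ?_⟩, ?_⟩
  · rw [mem_nonZeroDivisors_iff_ne_zero]
    intro h0
    have hnx : n * x = 0 := Ideal.span_eq_bot.1 h0 _ (by simp)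
    rw [hnx, map_zero] at hφa
    exact mul_ne_zero hmn ha hφa.symm
  · rw [Ideal.map_span, Set.image_pair, hφa, hφt, Ideal.span_mul_span', Set.singleton_mul,
      Set.image_pair]

end SIntegers

/-- The binary quadratic forms over `𝒪_{K,S}` of discriminant `1`
fall into finitely many orbits under the linear-substitution action of
`SL₂(𝒪_{K,S})`. -/
theorem finitely_many_SL2_orbits_of_disc_one_quadratics
    (K : Type*) [Field K] [NumberField K]
    (S : Finset (HeightOneSpectrum (𝓞 K))) :
    ∃ R : Set (MvPolynomial (Fin 2) ↥((S : Set (HeightOneSpectrum (𝓞 K))).integer K)),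
      R.Finite ∧
      (∀ g ∈ R, g.IsHomogeneous 2 ∧ disc2 g = 1) ∧
      ∀ f : MvPolynomial (Fin 2) ↥((S : Set (HeightOneSpectrum (𝓞 K))).integer K),
        f.IsHomogeneous 2 → disc2 f = 1 →
        ∃ g ∈ R, ∃ γ : Matrix.SpecialLinearGroup (Fin 2)
            ↥((S : Set (HeightOneSpectrum (𝓞 K))).integer K),
          f = substForm (γ : Matrix (Fin 2) (Fin 2)
            ↥((S : Set (HeightOneSpectrum (𝓞 K))).integer K)) g := by
  set A := (S : Set (HeightOneSpectrum (𝓞 K))).integer K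
  let φ := ringOfIntegersToInteger (S : Set (HeightOneSpectrum (𝓞 K)))
  let F : Set (MvPolynomial (Fin 2) A) := {f | ∃ a t c : A, a ≠ 0 ∧ a * c = t * (t + 1) ∧
    f = quadForm a (2 * t + 1) c}
  have key (f : MvPolynomial (Fin 2) A) : ∃ I : nonZeroDivisors (Ideal (𝓞 K)), f ∈ F →
      ∃ a t c d : A, a ≠ 0 ∧ d ≠ 0 ∧ a * c = t * (t + 1) ∧ f = quadForm a (2 * t + 1) c ∧
        Ideal.span {d} * Ideal.span {a, t} = (I : Ideal (𝓞 K)).map φ := by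
    by_cases hf : f ∈ F
    · obtain ⟨a, t, c, ha, h, rfl⟩ := hf
      obtain ⟨d, hd, I, hI⟩ := exists_span_mul_span_pair_eq_map _ ha t
      exact ⟨I, fun _ ↦ ⟨a, t, c, d, ha, hd, h, rfl, hI⟩⟩
    · exact ⟨1, fun h ↦ absurd h hf⟩
  choose I hI using key
  obtain ⟨T, hTF, hT, hrep⟩ := F.exists_finite_representatives fun f ↦ ClassGroup.mk0 (I f)
  refine ⟨insert (quadForm 0 1 0) T, hT.insert _, ?_, fun f hf hdisc ↦ ?_⟩
  · rintro g (rfl | hg)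
    · exact ⟨quadForm_isHomogeneous _ _ _, by rw [disc2_quadForm]; ring⟩
    · obtain ⟨a, t, c, -, h, rfl⟩ := hTF hg
      refine ⟨quadForm_isHomogeneous _ _ _, ?_⟩
      rw [disc2_quadForm]
      linear_combination -4 * h
  obtain ⟨a, b, c, rfl⟩ := hf.exists_eq_quadForm
  rw [disc2_quadForm] at hdisc
  by_cases ha : a = 0
  · subst ha
    exact ⟨_, Set.mem_insert _ _, exists_substForm_xy c (by linear_combination hdisc)⟩
  obtain ⟨t, rfl, h⟩ := exists_eq_two_mul_add_one _ hdisc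
  have hfF : quadForm a (2 * t + 1) c ∈ F := ⟨a, t, c, ha, h, rfl⟩
  obtain ⟨g, hg, hcl⟩ := hrep _ hfF
  refine ⟨g, Set.mem_insert_of_mem _ hg, ?_⟩
  obtain ⟨a₁, t₁, c₁, d₁, ha₁, hd₁, h₁, hf₁, hI₁⟩ := hI _ hfF
  obtain ⟨a₂, t₂, c₂, d₂, ha₂, hd₂, h₂, hf₂, hI₂⟩ := hI _ (hTF hg)
  obtain ⟨x, y, hx, hy, hxy⟩ := ClassGroup.mk0_eq_mk0_iff.1 hcl
  have hφ (z : 𝓞 K) (hz : z ≠ 0) : φ z ≠ 0 :=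
    (map_ne_zero_iff _ (ringOfIntegersToInteger_injective _)).2 hz
  have hmap := congrArg (Ideal.map φ) hxy
  rw [Ideal.map_mul, Ideal.map_mul, ← hI₁, ← hI₂, Ideal.map_span, Ideal.map_span,
    Set.image_singleton, Set.image_singleton, ← mul_assoc, ← mul_assoc,
    Ideal.span_singleton_mul_span_singleton, Ideal.span_singleton_mul_span_singleton] at hmap
  rw [hf₁, hf₂]
  exact exists_substForm_of_span_eq ha₁ ha₂ (mul_ne_zero (hφ x hx) hd₁)
    (mul_ne_zero (hφ y hy) hd₂) h₁ h₂ hmap
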